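/- arXiv:2503.12223 — 2 statements merged into one kernel-verified Lean document; each statement's English description precedes it below -/
import Mathlib

section
/- Let P1 and P2 be two finite posets such that at least one of them has the unique cover twin property and at least two elements. Then the induced saturation number sat*(n, P2 * P1) tends to infinity as n tends to infinity. -/
open Finset Filter

/-- An induced copy of the poset `α` inside the family `𝒜` of subsets of `Fin n`
(representing `[n] = {1,…,n}`): an injective map `f : α → Finset (Fin n)` with image
contained in `𝒜` such that `a ≤ b ↔ f a ⊆ f b`. -/
def IsInducedCopy {α : Type*} [PartialOrder α] {n : ℕ}
    (𝒜 : Finset (Finset (Fin n))) (f : α → Finset (Fin n)) : Prop :=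
  Function.Injective f ∧ (∀ a, f a ∈ 𝒜) ∧ ∀ a b : α, a ≤ b ↔ f a ⊆ f b

/-- The family `𝒜` contains an induced copy of the poset `α`. -/
def ContainsCopy (α : Type*) [PartialOrder α] {n : ℕ}
    (𝒜 : Finset (Finset (Fin n))) : Prop :=
  ∃ f : α → Finset (Fin n), IsInducedCopy 𝒜 f

/-- `𝒜` is an `α`-saturated family: it contains no induced copy of `α`, but adding any
set not in `𝒜` creates an induced copy of `α`. -/
def IsSaturatedFamily (α : Type*) [PartialOrder α] {n : ℕ}
    (𝒜 : Finset (Finset (Fin n))) : Prop :=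
  ¬ ContainsCopy α 𝒜 ∧
    ∀ S : Finset (Fin n), S ∉ 𝒜 → ContainsCopy α (insert S 𝒜)

/-- The induced saturation number `sat*(n, α)`: the minimum size of an `α`-saturated
family of subsets of `[n]`. -/
noncomputable def satStar (α : Type*) [PartialOrder α] (n : ℕ) : ℕ :=
  sInf {k : ℕ | ∃ 𝒜 : Finset (Finset (Fin n)), IsSaturatedFamily α 𝒜 ∧ 𝒜.card = k}

/-- The unique cover twin property (UCTP): whenever `p2` covers `p1`, there exists an
element comparable with exactly one of `p1` and `p2`. -/
def UCTP (α : Type*) [PartialOrder α] : Prop :=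
  ∀ p1 p2 : α, p1 ⋖ p2 →
    ∃ p3 : α, Xor' (p3 ≤ p1 ∨ p1 ≤ p3) (p3 ≤ p2 ∨ p2 ≤ p3)

section Copies

variable {n : ℕ} {𝒜 : Finset (Finset (Fin n))}

lemma isInducedCopy_of_le_iff {α : Type*} [PartialOrder α] {f : α → Finset (Fin n)}
    (hmem : ∀ a, f a ∈ 𝒜) (hle : ∀ a b, a ≤ b ↔ f a ⊆ f b) : IsInducedCopy 𝒜 f :=
  ⟨fun a b hab => le_antisymm ((hle a b).2 hab.le) ((hle b a).2 hab.ge), hmem, hle⟩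

lemma containsCopy_sumLex_iff {α β : Type*} [PartialOrder α] [PartialOrder β] :
    ContainsCopy (α ⊕ₗ β) 𝒜 ↔ ∃ (g : α → Finset (Fin n)) (h : β → Finset (Fin n)),
      IsInducedCopy 𝒜 g ∧ IsInducedCopy 𝒜 h ∧ ∀ a b, g a ⊂ h b := by
  constructor
  · rintro ⟨f, -, hmem, hle⟩
    refine ⟨fun a => f (Sum.inlₗ a), fun b => f (Sum.inrₗ b),
      isInducedCopy_of_le_iff (fun a => hmem _) fun a b => ?_,
      isInducedCopy_of_le_iff (fun a => hmem _) fun a b => ?_, fun a b => ?_⟩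
    · rw [← hle, Sum.Lex.inl_le_inl_iff]
    · rw [← hle, Sum.Lex.inr_le_inr_iff]
    · rw [ssubset_iff_subset_not_subset, ← hle, ← hle]
      exact ⟨(Sum.Lex.inl_lt_inr a b).le, Sum.Lex.not_inr_le_inl⟩
  · rintro ⟨g, h, ⟨-, hg, hgle⟩, ⟨-, hh, hhle⟩, hgh⟩
    refine ⟨fun x => Sum.elim g h (ofLex x), isInducedCopy_of_le_iff ?_ ?_⟩
    · rintro (a | b)
      · exact hg a
      · exact hh b
    · rintro (a | a) (b | b)
      · exact Sum.Lex.inl_le_inl_iff.trans (hgle a b)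
      · exact iff_of_true (Sum.Lex.inl_lt_inr a b).le (hgh a b).subset
      · exact iff_of_false Sum.Lex.not_inr_le_inl (hgh b a).not_subset
      · exact Sum.Lex.inr_le_inr_iff.trans (hhle a b)

lemma IsInducedCopy.of_insert {α : Type*} [PartialOrder α] {S : Finset (Fin n)}
    {f : α → Finset (Fin n)} (hf : IsInducedCopy (insert S 𝒜) f) (hS : ∀ a, f a ≠ S) :
    IsInducedCopy 𝒜 f :=
  ⟨hf.1, fun a => Finset.mem_of_mem_insert_of_ne (hf.2.1 a) (hS a), hf.2.2⟩

lemma exists_isSaturatedFamily (α : Type*) [PartialOrder α] [Nonempty α] (n : ℕ) :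
    ∃ 𝒜 : Finset (Finset (Fin n)), IsSaturatedFamily α 𝒜 := by
  have hempty : ¬ ContainsCopy α (∅ : Finset (Finset (Fin n))) := by
    rintro ⟨f, -, hf, -⟩
    exact Finset.notMem_empty _ (hf (Classical.arbitrary α))
  obtain ⟨𝒜, h𝒜⟩ := Set.Finite.exists_maximal
    (Set.toFinite {𝒜 : Finset (Finset (Fin n)) | ¬ ContainsCopy α 𝒜}) ⟨∅, hempty⟩
  refine ⟨𝒜, h𝒜.prop, fun S hS => ?_⟩
  by_contra hcopy
  exact hS (h𝒜.le_of_ge hcopy (Finset.subset_insert S 𝒜) (Finset.mem_insert_self S 𝒜))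

end Copies

section Twins

variable {α : Type*} [PartialOrder α]

lemma UCTP.exists_xor (hα : UCTP α) {b c : α} (hbc : b ⋖ c) :
    ∃ d : α, Xor (d ≤ b ∨ b ≤ d) (d ≤ c ∨ c ≤ d) :=
  hα b c hbc

lemma UCTP.not_twins (hα : UCTP α) {b c : α} (hne : b ≠ c) (hcomp : b ≤ c ∨ c ≤ b)
    (htwin : ∀ d, d ≠ b → d ≠ c → ((d ≤ b ↔ d ≤ c) ∧ (b ≤ d ↔ c ≤ d))) : False := by
  wlog hbc : b ≤ c generalizing b c
  · exact this hne.symm hcomp.symm (fun d hc hb => ⟨(htwin d hb hc).1.symm, (htwin d hb hc).2.symm⟩)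
      (hcomp.resolve_left hbc)
  have hcov : b ⋖ c := ⟨lt_of_le_of_ne hbc hne, fun d hbd hdc =>
    hbd.not_ge ((htwin d hbd.ne' hdc.ne).1.2 hdc.le)⟩
  obtain ⟨d, hd⟩ := hα.exists_xor hcov
  by_cases hdb : d = b
  · subst hdb
    simp [hbc, Xor] at hd
  by_cases hdc : d = c
  · subst hdc
    simp [hbc, Xor] at hd
  · rw [(htwin d hdb hdc).1, (htwin d hdb hdc).2, xor_self] at hd
    exact hd

lemma UCTP.dual (hα : UCTP α) : UCTP αᵒᵈ := by
  intro p q hpq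
  obtain ⟨r, hr⟩ := hα.exists_xor hpq.ofDual
  refine ⟨OrderDual.toDual r, ?_⟩
  rw [xor_comm, or_comm, @or_comm (r ≤ _)] at hr
  exact hr

end Twins

/-- `X` lies strictly above every member of some induced copy of `α` in `𝒜`. -/
def LiesAboveCopy (α : Type*) [PartialOrder α] {n : ℕ}
    (𝒜 : Finset (Finset (Fin n))) (X : Finset (Fin n)) : Prop :=
  ∃ g : α → Finset (Fin n), IsInducedCopy 𝒜 g ∧ ∀ a, g a ⊂ X

section Saturated

variable {α β : Type*} [PartialOrder α] [PartialOrder β] {n : ℕ}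
  {𝒜 : Finset (Finset (Fin n))}

lemma IsSaturatedFamily.not_twin_sets (h𝒜 : IsSaturatedFamily (α ⊕ₗ β) 𝒜) (hβ : UCTP β)
    {C S : Finset (Fin n)} (hC : C ∈ 𝒜) (hCα : LiesAboveCopy α 𝒜 C) (hS : S ∉ 𝒜)
    (hcomp : C ⊆ S ∨ S ⊆ C)
    (h_above : ∀ X ∈ 𝒜, S ⊆ X → C ⊆ X) (h_below : ∀ X ∈ 𝒜, X ⊆ S → X ⊆ C)
    (h_above' : ∀ X ∈ 𝒜, LiesAboveCopy α 𝒜 X → X ≠ C → C ⊆ X → S ⊆ X)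
    (h_below' : ∀ X ∈ 𝒜, LiesAboveCopy α 𝒜 X → X ≠ C → X ⊆ C → X ⊆ S) : False := by
  classical
  have hfree := h𝒜.1
  rw [containsCopy_sumLex_iff] at hfree
  obtain ⟨g₀, hg₀, hg₀C⟩ := hCα
  obtain ⟨g, h, hg, hh, hgh⟩ := containsCopy_sumLex_iff.1 (h𝒜.2 S hS)
  by_cases hgS : ∃ a, g a = S
  · obtain ⟨a, rfl⟩ := hgS
    have hh' := hh.of_insert fun b hb => (hgh a b).ne hb.symm
    exact hfree ⟨g₀, h, hg₀, hh', fun a' b =>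
      (hg₀C a').trans_subset (h_above _ (hh'.2.1 b) (hgh a b).subset)⟩
  push Not at hgS
  replace hg := hg.of_insert hgS
  by_cases hhS : ∃ b, h b = S
  swap
  · push Not at hhS
    exact hfree ⟨g, h, hg, hh.of_insert hhS, hgh⟩
  obtain ⟨b₀, hb₀⟩ := hhS
  have hmem : ∀ b, b ≠ b₀ → h b ∈ 𝒜 := fun b hb =>
    Finset.mem_of_mem_insert_of_ne (hh.2.1 b) fun hbS => hb (hh.1 (hbS.trans hb₀.symm))
  have hlies : ∀ b, LiesAboveCopy α 𝒜 (h b) := fun b => ⟨g, hg, fun a => hgh a b⟩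
  have hup : ∀ b, b ≠ b₀ → h b ≠ C → (b₀ ≤ b ↔ C ⊆ h b) := fun b hb hbC => by
    rw [hh.2.2, hb₀]
    exact ⟨h_above _ (hmem b hb), h_above' _ (hmem b hb) (hlies b) hbC⟩
  have hdown : ∀ b, b ≠ b₀ → h b ≠ C → (b ≤ b₀ ↔ h b ⊆ C) := fun b hb hbC => by
    rw [hh.2.2, hb₀]
    exact ⟨h_below _ (hmem b hb), h_below' _ (hmem b hb) (hlies b) hbC⟩
  by_cases hhC : ∃ b, h b = C
  · obtain ⟨b₁, rfl⟩ := hhC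
    refine hβ.not_twins (b := b₀) (c := b₁) ?_ ?_ fun d hd₀ hd₁ => ?_
    · rintro rfl
      exact hS (hb₀ ▸ hC)
    · rw [hh.2.2, hh.2.2, hb₀]
      exact hcomp.symm
    · rw [hup d hd₀ (hh.1.ne hd₁), hdown d hd₀ (hh.1.ne hd₁), hh.2.2, hh.2.2]
      exact ⟨Iff.rfl, Iff.rfl⟩
  push Not at hhC
  have hh' : IsInducedCopy 𝒜 (Function.update h b₀ C) := by
    refine isInducedCopy_of_le_iff (fun b => ?_) fun b c => ?_
    · by_cases hb : b = b₀
      · simpa [hb] using hC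
      · simpa [hb] using hmem b hb
    · by_cases hb : b = b₀ <;> by_cases hc : c = b₀
      · simp [hb, hc]
      · simpa [hb, hc] using hup c hc (hhC c)
      · simpa [hb, hc] using hdown b hb (hhC b)
      · simpa [hb, hc] using hh.2.2 b c
  by_cases hgC : ∃ a, g a = C
  · obtain ⟨a, rfl⟩ := hgC
    refine hfree ⟨g₀, _, hg₀, hh', fun a' b => ?_⟩
    by_cases hb : b = b₀
    · simpa [hb] using hg₀C a'
    · simpa [hb] using (hg₀C a').trans (hgh a b)
  · push Not at hgC
    refine hfree ⟨g, _, hg, hh', fun a b => ?_⟩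
    by_cases hb : b = b₀
    · simpa [hb] using
        (h_below _ (hg.2.1 a) (hb₀ ▸ (hgh a b₀).subset)).ssubset_of_ne (hgC a)
    · simpa [hb] using hgh a b

lemma IsSaturatedFamily.not_liesAboveCopy (h𝒜 : IsSaturatedFamily (α ⊕ₗ β) 𝒜) (hβ : UCTP β)
    {i j : Fin n} (hij : i ≠ j) (hsep : ∀ X ∈ 𝒜, (i ∈ X ↔ j ∈ X))
    {X : Finset (Fin n)} (hX : X ∈ 𝒜) : ¬ LiesAboveCopy α 𝒜 X := by
  intro hXα
  by_cases hi : i ∈ X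
  · obtain ⟨B, -, hB⟩ := (Set.toFinite
      {Y | Y ∈ 𝒜 ∧ LiesAboveCopy α 𝒜 Y ∧ i ∈ Y}).exists_le_minimal ⟨hX, hXα, hi⟩
    obtain ⟨hB𝒜, hBα, hiB⟩ := hB.prop
    have hjB := (hsep B hB𝒜).1 hiB
    refine h𝒜.not_twin_sets hβ (S := B.erase i) hB𝒜 hBα (fun hS => ?_)
      (Or.inr (Finset.erase_subset i B)) (fun Y hY hBY => ?_)
      (fun Y _ hYB => hYB.trans (Finset.erase_subset i B))
      (fun Y _ _ _ hBY => (Finset.erase_subset i B).trans hBY) (fun Y hY hYα hYB hYsub => ?_)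
    · simpa [hij.symm, hjB] using hsep _ hS
    · have hjY : j ∈ Y := hBY (Finset.mem_erase.2 ⟨hij.symm, hjB⟩)
      exact (Finset.insert_erase hiB).symm.subset.trans
        (Finset.insert_subset ((hsep Y hY).2 hjY) hBY)
    · refine Finset.subset_erase.2 ⟨hYsub, fun hiY => hYB ?_⟩
      exact hYsub.antisymm (hB.le_of_le ⟨hY, hYα, hiY⟩ hYsub)
  · obtain ⟨A, -, hA⟩ := (Set.toFinite
      {Y | Y ∈ 𝒜 ∧ LiesAboveCopy α 𝒜 Y ∧ i ∉ Y}).exists_le_maximal ⟨hX, hXα, hi⟩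
    obtain ⟨hA𝒜, hAα, hiA⟩ := hA.prop
    have hjA : j ∉ A := fun hj => hiA ((hsep A hA𝒜).2 hj)
    refine h𝒜.not_twin_sets hβ (S := insert i A) hA𝒜 hAα (fun hS => ?_)
      (Or.inl (Finset.subset_insert i A)) (fun Y _ hAY => (Finset.subset_insert i A).trans hAY)
      (fun Y hY hYA => ?_) (fun Y hY hYα hYA hAY => ?_)
      (fun Y _ _ _ hYA => hYA.trans (Finset.subset_insert i A))
    · simpa [hij.symm, hjA] using hsep _ hS
    · refine (Finset.subset_insert_iff_of_notMem fun hiY => ?_).1 hYA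
      have := hYA ((hsep Y hY).1 hiY)
      simp [hij.symm, hjA] at this
    · refine Finset.insert_subset ?_ hAY
      by_contra hiY
      exact hYA ((hA.le_of_ge ⟨hY, hYα, hiY⟩ hAY).antisymm hAY)

lemma IsSaturatedFamily.exists_separating (h𝒜 : IsSaturatedFamily (α ⊕ₗ β) 𝒜) (hβ : UCTP β)
    [Nontrivial β] (hcard : 𝒜.card < n) {i j : Fin n} (hij : i ≠ j) :
    ∃ X ∈ 𝒜, ¬ (i ∈ X ↔ j ∈ X) := by
  by_contra! hsep
  replace hsep : ∀ X ∈ 𝒜, (i ∈ X ↔ j ∈ X) := fun X hX => by simpa using hsep X hX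
  obtain ⟨x, hx⟩ : ∃ x : Fin n, ({x}ᶜ : Finset (Fin n)) ∉ 𝒜 := by
    by_contra! hall
    have := Finset.card_le_card_of_injOn (s := (Finset.univ : Finset (Fin n))) (t := 𝒜)
      (fun x => ({x}ᶜ : Finset (Fin n))) (fun x _ => hall x)
      (fun x _ y _ hxy => by simpa using hxy)
    rw [Finset.card_univ, Fintype.card_fin] at this
    omega
  obtain ⟨g, h, hg, hh, hgh⟩ := containsCopy_sumLex_iff.1 (h𝒜.2 _ hx)
  by_cases hgS : ∃ a, g a = {x}ᶜ
  · obtain ⟨a, ha⟩ := hgS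
    have htop : ∀ b, h b = Finset.univ := fun b => by
      have hb := hgh a b
      rw [ha] at hb
      have hxb : x ∈ h b := by
        by_contra hxb
        exact hb.not_subset fun y hy => by
          simp only [Finset.mem_compl, Finset.mem_singleton]
          rintro rfl
          exact hxb hy
      refine Finset.eq_univ_of_forall fun y => ?_
      by_cases hy : y = x
      · exact hy ▸ hxb
      · exact hb.subset (by simpa using hy)
    obtain ⟨b, c, hbc⟩ := exists_pair_ne β
    exact hbc (hh.1 ((htop b).trans (htop c).symm))
  · push Not at hgS
    obtain ⟨b, hb⟩ : ∃ b, h b ≠ {x}ᶜ := by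
      by_contra! hall
      obtain ⟨b, c, hbc⟩ := exists_pair_ne β
      exact hbc (hh.1 ((hall b).trans (hall c).symm))
    exact h𝒜.not_liesAboveCopy hβ hij hsep (Finset.mem_of_mem_insert_of_ne (hh.2.1 b) hb)
      ⟨g, hg.of_insert hgS, fun a => hgh a b⟩

lemma IsSaturatedFamily.le_two_pow_card (h𝒜 : IsSaturatedFamily (α ⊕ₗ β) 𝒜) (hβ : UCTP β)
    [Nontrivial β] : n ≤ 2 ^ 𝒜.card := by
  rcases le_or_gt n 𝒜.card with hn | hn
  · exact hn.trans Nat.lt_two_pow_self.le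
  have := Finset.card_le_card_of_injOn (s := (Finset.univ : Finset (Fin n))) (t := 𝒜.powerset)
    (fun i => 𝒜.filter (i ∈ ·)) (fun i _ => Finset.mem_powerset.2 (Finset.filter_subset _ 𝒜)) (fun i _ j _ hij => by
      by_contra hne
      obtain ⟨X, hX, hsep⟩ := h𝒜.exists_separating hβ hn hne
      exact hsep (by simpa [hX] using Finset.ext_iff.1 hij X))
  rwa [Finset.card_univ, Fintype.card_fin, Finset.card_powerset] at this

end Saturated

section Duality

variable {α β : Type*} [PartialOrder α] [PartialOrder β] {n : ℕ}
  {𝒜 : Finset (Finset (Fin n))}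

lemma ContainsCopy.compl (e : β ≃o αᵒᵈ) (h : ContainsCopy α 𝒜) :
    ContainsCopy β (𝒜.image (·ᶜ)) := by
  obtain ⟨f, -, hmem, hle⟩ := h
  refine ⟨fun b => (f (OrderDual.ofDual (e b)))ᶜ, isInducedCopy_of_le_iff
    (fun b => Finset.mem_image_of_mem _ (hmem _)) fun b c => ?_⟩
  rw [Finset.compl_subset_compl, ← hle, OrderDual.ofDual_le_ofDual, e.le_iff_le]

lemma IsSaturatedFamily.compl (e : β ≃o αᵒᵈ) (h : IsSaturatedFamily α 𝒜) :
    IsSaturatedFamily β (𝒜.image (·ᶜ)) := by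
  have himage : ∀ ℬ : Finset (Finset (Fin n)), (ℬ.image (·ᶜ)).image (·ᶜ) = ℬ := fun ℬ => by
    simp
  refine ⟨fun hcopy => h.1 ?_, fun S hS => ?_⟩
  · have := hcopy.compl ((OrderIso.dualDual α).trans e.symm.dual)
    rwa [himage] at this
  · have hS' : Sᶜ ∉ 𝒜 := fun hmem => hS (Finset.mem_image.2 ⟨Sᶜ, hmem, compl_compl S⟩)
    simpa [Finset.image_insert] using (h.2 _ hS').compl e

end Duality

/-- If `P1`, `P2` are finite posets and at least one of them has the
UCTP and at least two elements, then `sat*(n, P2 * P1) → ∞` as `n → ∞`. The linear sum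
`P2 * P1` (with `P1` at the bottom) is encoded as `P1 ⊕ₗ P2`. -/
theorem statement2 (P1 P2 : Type*) [PartialOrder P1] [Fintype P1]
    [PartialOrder P2] [Fintype P2]
    (h : (UCTP P1 ∧ 2 ≤ Fintype.card P1) ∨ (UCTP P2 ∧ 2 ≤ Fintype.card P2)) :
    Tendsto (fun n => satStar (P1 ⊕ₗ P2) n) atTop atTop := by
  have hbound : ∀ (n : ℕ) (𝒜 : Finset (Finset (Fin n))),
      IsSaturatedFamily (P1 ⊕ₗ P2) 𝒜 → n ≤ 2 ^ 𝒜.card := by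
    intro n 𝒜 h𝒜
    rcases h with ⟨hU, hcard⟩ | ⟨hU, hcard⟩
    · have : Nontrivial P1 := Fintype.one_lt_card_iff_nontrivial.1 hcard
      have := (h𝒜.compl (OrderIso.sumLexDualAntidistrib P1 P2).symm).le_two_pow_card hU.dual
      rwa [Finset.card_image_of_injective _ compl_injective] at this
    · have : Nontrivial P2 := Fintype.one_lt_card_iff_nontrivial.1 hcard
      exact h𝒜.le_two_pow_card hU
  have : Nonempty (P1 ⊕ₗ P2) := by
    rcases h with ⟨-, hcard⟩ | ⟨-, hcard⟩
    · obtain ⟨a⟩ := Fintype.card_pos_iff.1 (zero_lt_two.trans_le hcard)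
      exact ⟨Sum.inlₗ a⟩
    · obtain ⟨b⟩ := Fintype.card_pos_iff.1 (zero_lt_two.trans_le hcard)
      exact ⟨Sum.inrₗ b⟩
  refine tendsto_atTop.2 fun k => eventually_atTop.2 ⟨2 ^ k, fun n hn => ?_⟩
  obtain ⟨ℬ, hℬ⟩ := exists_isSaturatedFamily (P1 ⊕ₗ P2) n
  obtain ⟨𝒜, h𝒜, hcard⟩ := Nat.sInf_mem
    (s := {k : ℕ | ∃ 𝒜 : Finset (Finset (Fin n)), IsSaturatedFamily (P1 ⊕ₗ P2) 𝒜 ∧ 𝒜.card = k})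
    ⟨_, ℬ, hℬ, rfl⟩
  have hpow := hn.trans (hbound n 𝒜 h𝒜)
  rw [hcard] at hpow
  exact (Nat.pow_le_pow_iff_right one_lt_two).1 hpow
end

section
/- Let P1 and P2 be two special posets such that sat*(n, P1) and sat*(n, P2) are both bounded (each bounded above by a constant independent of n). Then sat*(n, P2 * P1) is bounded. -/
open Finset Filter

/-- A poset is special if it consists of an element `z` incomparable to every other
element, together with the rest of the poset, which has both a greatest and a least
element. -/
def IsSpecial (α : Type*) [PartialOrder α] : Prop :=
  ∃ z : α, (∀ x : α, x ≠ z → ¬ x ≤ z ∧ ¬ z ≤ x) ∧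
    (∃ t : α, t ≠ z ∧ ∀ x : α, x ≠ z → x ≤ t) ∧
    (∃ b : α, b ≠ z ∧ ∀ x : α, x ≠ z → b ≤ x)

/-- The set `A` in an ordered type contains an induced copy of `α`. -/
def HasCopy (α : Type*) [LE α] {L : Type*} [LE L] (A : Set L) : Prop :=
  ∃ f : α → L, (∀ a b, f a ≤ f b ↔ a ≤ b) ∧ ∀ a, f a ∈ A

/-- Saturation for subsets of an arbitrary ordered type. -/
def SaturatedSet (α : Type*) [LE α] {L : Type*} [LE L] (A : Set L) : Prop :=
  ¬ HasCopy α A ∧ ∀ S, S ∉ A → HasCopy α (insert S A)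

/-- The sets of size at most `j` and at least `j + 1 - b`. -/
def layers (K : Type*) (b j : ℕ) : Set (Finset K) :=
  {c | c.card ≤ j ∧ j + 1 ≤ c.card + b}

/-- Copies of `F` placed above each `j`-set of `K`, together with `layers K b j`. -/
def halfFamily (K : Type*) {R : Type*} (b j : ℕ) (F : Set (Finset R)) :
    Set (Finset K × Finset R) :=
  {S | (S.2 = ∅ ∧ S.1 ∈ layers K b j) ∨ (S.1.card = j ∧ S.2 ∈ F)}

theorem HasCopy.mono {α L : Type*} [LE α] [LE L] {A B : Set L} (h : HasCopy α A)
    (hAB : A ⊆ B) : HasCopy α B := by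
  obtain ⟨f, hf, hA⟩ := h
  exact ⟨f, hf, fun a => hAB (hA a)⟩

theorem containsCopy_iff_hasCopy {α : Type*} [PartialOrder α] {n : ℕ}
    (𝒜 : Finset (Finset (Fin n))) :
    ContainsCopy α 𝒜 ↔ HasCopy α (𝒜 : Set (Finset (Fin n))) := by
  constructor
  · rintro ⟨f, -, hA, hf⟩
    exact ⟨f, fun a b => (hf a b).symm, hA⟩
  · rintro ⟨f, hf, hA⟩
    refine ⟨f, fun a b hab => ?_, hA, fun a b => (hf a b).symm⟩
    exact le_antisymm ((hf a b).1 hab.le) ((hf b a).1 hab.ge)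

theorem IsSaturatedFamily.saturatedSet {α : Type*} [PartialOrder α] {n : ℕ}
    {𝒜 : Finset (Finset (Fin n))} (h : IsSaturatedFamily α 𝒜) :
    SaturatedSet α (𝒜 : Set (Finset (Fin n))) := by
  refine ⟨fun hc => h.1 ((containsCopy_iff_hasCopy 𝒜).2 hc), fun S hS => ?_⟩
  have := (containsCopy_iff_hasCopy _).1 (h.2 S (by simpa using hS))
  rwa [Finset.coe_insert] at this

/-- Every family without a copy of `α` extends to a saturated family. -/
theorem exists_isSaturatedFamily_superset {α : Type*} [PartialOrder α] {n : ℕ}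
    {𝒢 : Finset (Finset (Fin n))} (h : ¬ ContainsCopy α 𝒢) :
    ∃ 𝒜, 𝒢 ⊆ 𝒜 ∧ IsSaturatedFamily α 𝒜 := by
  obtain ⟨𝒜, hle, hmax⟩ := (Set.toFinite {𝒜 : Finset (Finset (Fin n)) |
    ¬ ContainsCopy α 𝒜}).exists_le_maximal h
  refine ⟨𝒜, hle, hmax.prop, fun S hS => ?_⟩
  by_contra hc
  exact hS (hmax.le_of_ge hc (Finset.subset_insert S 𝒜) (Finset.mem_insert_self S 𝒜))

theorem exists_isSaturatedFamily_card_eq_satStar {α : Type*} [PartialOrder α] [Nonempty α]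
    (n : ℕ) : ∃ 𝒜 : Finset (Finset (Fin n)), IsSaturatedFamily α 𝒜 ∧ 𝒜.card = satStar α n := by
  apply Nat.sInf_mem (s := {k | ∃ 𝒜 : Finset (Finset (Fin n)), IsSaturatedFamily α 𝒜 ∧ 𝒜.card = k})
  have h : ¬ ContainsCopy α (∅ : Finset (Finset (Fin n))) := by
    rintro ⟨f, -, hA, -⟩
    exact absurd (hA (Classical.arbitrary α)) (by simp)
  obtain ⟨𝒜, -, h𝒜⟩ := exists_isSaturatedFamily_superset h
  exact ⟨_, 𝒜, h𝒜, rfl⟩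

theorem IsSpecial.nonempty {α : Type*} [PartialOrder α] (h : IsSpecial α) : Nonempty α :=
  let ⟨z, _⟩ := h
  ⟨z⟩

theorem IsSpecial.exists_not_le {α : Type*} [PartialOrder α] (h : IsSpecial α) (a : α) :
    ∃ b, ¬ b ≤ a := by
  obtain ⟨z, hz, ⟨t, htz, -⟩, -⟩ := h
  by_cases haz : a = z
  · exact ⟨t, haz ▸ (hz t htz).1⟩
  · exact ⟨z, (hz a haz).2⟩

theorem IsSpecial.orderDual {α : Type*} [PartialOrder α] (h : IsSpecial α) :
    IsSpecial αᵒᵈ := by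
  obtain ⟨z, hz, ht, hb⟩ := h
  exact ⟨OrderDual.toDual z, fun x hx => ⟨(hz (OrderDual.ofDual x) hx).2,
    (hz (OrderDual.ofDual x) hx).1⟩, hb, ht⟩

theorem hasCopy_orderDual_compl {α L : Type*} [LE α] [BooleanAlgebra L] {A : Set L} :
    HasCopy αᵒᵈ (compl ⁻¹' A) ↔ HasCopy α A := by
  constructor
  · rintro ⟨f, hf, hA⟩
    exact ⟨fun a => (f (OrderDual.toDual a))ᶜ,
      fun a b => compl_le_compl_iff_le.trans (hf _ _), fun a => hA _⟩
  · rintro ⟨f, hf, hA⟩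
    exact ⟨fun a => (f (OrderDual.ofDual a))ᶜ,
      fun a b => compl_le_compl_iff_le.trans (hf _ _), fun a => by simpa using hA _⟩

theorem compl_preimage_insert {L : Type*} [BooleanAlgebra L] (S : L) (A : Set L) :
    compl ⁻¹' (insert S A) = insert Sᶜ (compl ⁻¹' A) := by
  ext x
  simp only [Set.mem_preimage, Set.mem_insert_iff, compl_eq_comm (x := x), eq_comm (a := x)]

theorem SaturatedSet.orderDual {α L : Type*} [LE α] [BooleanAlgebra L] {A : Set L}
    (h : SaturatedSet α A) : SaturatedSet αᵒᵈ (compl ⁻¹' A) := by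
  refine ⟨fun hc => h.1 (hasCopy_orderDual_compl.1 hc), fun S hS => ?_⟩
  have := hasCopy_orderDual_compl.2 (h.2 Sᶜ hS)
  rwa [compl_preimage_insert, compl_compl] at this

/-- `P` embeds into the proper subsets of some finite set with complement of size at most `b`. -/
def EmbedsInCodim (P : Type*) [LE P] (b : ℕ) : Prop :=
  ∃ v : ℕ, HasCopy P {c : Finset (Fin v) | c ≠ univ ∧ v ≤ c.card + b}

theorem IsSpecial.exists_embedsInCodim {P : Type*} [PartialOrder P] [Fintype P]
    (h : IsSpecial P) : ∃ b, EmbedsInCodim P b := by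
  classical
  let e := Fintype.equivFin P
  refine ⟨Fintype.card P, Fintype.card P, fun p => univ.filter fun i => e.symm i ≤ p,
    fun a b => ⟨fun hab => ?_, fun hab i => ?_⟩, fun a => ⟨fun hu => ?_, by omega⟩⟩
  · have := @hab (e a)
    simpa using this
  · simpa using fun hi => hi.trans hab
  · obtain ⟨b, hb⟩ := h.exists_not_le a
    dsimp only at hu
    have : e b ∈ univ.filter fun i => e.symm i ≤ a := by rw [hu]; simp
    exact hb (by simpa using this)

/-- An induced copy of `P` in the top layers of an abstract finite set transfers to every
sufficiently large subset of `K`. -/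
theorem hasCopy_layers_of_card {P : Type*} [LE P] {b v : ℕ}
    (h : HasCopy P {c : Finset (Fin v) | c ≠ univ ∧ v ≤ c.card + b})
    {K : Type*} {j : ℕ} (hvj : v ≤ j + 1) {Y : Finset K} (hY : Y.card = j + 1) :
    HasCopy P {c | c ∈ layers K b j ∧ c ⊆ Y} := by
  classical
  obtain ⟨f, hf, hC⟩ := h
  obtain ⟨W, hWY, hW⟩ := Finset.exists_subset_card_eq (hvj.trans hY.ge)
  let e := (W.equivFinOfCardEq hW).symm
  let i : Fin v ↪ K := e.toEmbedding.trans (Function.Embedding.subtype _)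
  have hi : ∀ x, i x ∈ W := fun x => (e x).2
  have hmap : ∀ c : Finset (Fin v), c.map i ⊆ W := fun c x hx => by
    obtain ⟨y, -, rfl⟩ := Finset.mem_map.1 hx
    exact hi y
  have hdisj : ∀ c : Finset (Fin v), Disjoint (c.map i) (Y \ W) := fun c =>
    Finset.disjoint_sdiff.mono_left (hmap c)
  have hcard : ∀ c : Finset (Fin v), (c.map i ∪ (Y \ W)).card + v = c.card + (j + 1) := fun c => by
    rw [Finset.card_union_of_disjoint (hdisj c), Finset.card_map,
      Finset.card_sdiff_of_subset hWY]
    omega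
  refine ⟨fun p => (f p).map i ∪ (Y \ W), fun a b => ?_, fun a => ⟨⟨?_, ?_⟩, ?_⟩⟩
  · rw [← hf]
    constructor
    · intro hab x hx
      have h1 := hab (Finset.mem_union_left _ (Finset.mem_map_of_mem i hx))
      rcases Finset.mem_union.1 h1 with h2 | h2
      · simpa using h2
      · exact absurd (hi x) (Finset.mem_sdiff.1 h2).2
    · intro hab
      exact Finset.union_subset_union (Finset.map_subset_map.2 hab) subset_rfl
  · have h1 := hcard (f a)
    have h2 : (f a).card < v := by
      simpa using (Finset.card_lt_iff_ne_univ (f a)).2 (hC a).1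
    dsimp only
    omega
  · have h1 := hcard (f a)
    have h2 := (hC a).2
    dsimp only
    omega
  · exact Finset.union_subset ((hmap _).trans hWY) Finset.sdiff_subset

/-- If `P` embeds in no codimension below `b`, a `j`-set contains no copy of `P` from the layers. -/
theorem not_hasCopy_layers_of_card {P : Type*} [PartialOrder P] (hP : IsSpecial P) {b : ℕ}
    (h : ∀ b' < b, ¬ EmbedsInCodim P b') {K : Type*} {j : ℕ} {Y : Finset K} (hY : Y.card = j) :
    ¬ HasCopy P {c | c ∈ layers K b j ∧ c ⊆ Y} := by
  classical
  rintro ⟨f, hf, hC⟩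
  let e := Y.equivFinOfCardEq hY
  have hne : ∀ a, f a ≠ Y := fun a ha => by
    obtain ⟨c, hc⟩ := hP.exists_not_le a
    exact hc ((hf c a).1 (ha ▸ (hC c).2))
  have hlt : ∀ a, (f a).card < j := fun a =>
    hY ▸ Finset.card_lt_card ((hC a).2.ssubset_of_ne (hne a))
  obtain ⟨a₀⟩ := hP.nonempty
  have hb : 0 < b := by
    have := (hC a₀).1.2
    have := hlt a₀
    omega
  let i : Fin j ↪ K := e.symm.toEmbedding.trans (Function.Embedding.subtype _)
  have hmap : ∀ c ⊆ Y, ((univ.filter fun x => i x ∈ c).map i) = c := fun c hc => by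
    ext y
    simp only [Finset.mem_map, Finset.mem_filter, Finset.mem_univ, true_and]
    constructor
    · rintro ⟨x, hx, rfl⟩
      exact hx
    · intro hy
      have : i (e ⟨y, hc hy⟩) = y := by simp [i]
      exact ⟨e ⟨y, hc hy⟩, by rwa [this], this⟩
  refine h (b - 1) (by omega) ⟨j, fun p => univ.filter fun x => i x ∈ f p, fun a c => ?_,
    fun a => ?_⟩
  · rw [← hf, ← Finset.map_subset_map (f := i), hmap _ (hC a).2, hmap _ (hC c).2]
  · have hcard := congrArg Finset.card (hmap _ (hC a).2)
    rw [Finset.card_map] at hcard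
    refine ⟨fun hu => ?_, ?_⟩
    · have := hlt a
      dsimp only at hu
      rw [hu, Finset.card_univ, Fintype.card_fin] at hcard
      omega
    · have := (hC a).1.2
      dsimp only
      omega

/-- For every set `s` with fewer than `j` elements, the part of a special poset other than its
isolated element `z` embeds into the layers below a `j`-set containing `s`, with no member
contained in `s`. -/
theorem exists_copy_not_subset {P : Type*} [PartialOrder P] {z t u : P}
    (ht : t ≠ z ∧ ∀ x : P, x ≠ z → x ≤ t) (hu : u ≠ z ∧ ∀ x : P, x ≠ z → u ≤ x)
    (hz : ¬ z ≤ t) {K : Type*} [Fintype K] {b j : ℕ} (hbj : b ≤ j) (hK : j + 1 ≤ Fintype.card K)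
    (h : ∀ Y : Finset K, Y.card = j + 1 → HasCopy P {c | c ∈ layers K b j ∧ c ⊆ Y})
    {s : Finset K} (hs : s.card < j) :
    ∃ T : Finset K, T.card = j ∧ s ⊆ T ∧ ∃ g : P → Finset K,
      (∀ x y, g x ≤ g y ↔ x ≤ y) ∧ ∀ x, x ≠ z → g x ∈ layers K b j ∧ g x ⊆ T ∧ ¬ g x ⊆ s := by
  classical
  obtain ⟨Y, -, hY⟩ := Finset.exists_subset_card_eq (s := (univ : Finset K))
    (hK.trans_eq Finset.card_univ.symm)
  obtain ⟨f, hf, hC⟩ := h Y hY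
  have hss : f t ⊂ Y := (hC t).2.ssubset_of_ne fun hft =>
    hz ((hf z t).1 (hft ▸ (hC z).2))
  obtain ⟨y, hyY, hyt⟩ := Finset.exists_of_ssubset hss
  have hbot : (f u).Nonempty := by
    rw [← Finset.card_pos]
    have := (hC u).1.2
    omega
  obtain ⟨x, hx⟩ := hbot
  have hle : ∀ p, p ≠ z → f p ⊆ Y.erase y := fun p hp w hw =>
    Finset.mem_erase.2 ⟨fun hwy => hyt (hwy ▸ (hf p t).2 (ht.2 p hp) hw), (hC p).2 hw⟩
  have hcardD : (Y.erase y).card = j := by rw [Finset.card_erase_of_mem hyY, hY]; rfl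
  have hxD : x ∈ Y.erase y := hle u hu.1 hx
  obtain ⟨s', hs'D, hs'⟩ := Finset.exists_subset_card_eq (s := (Y.erase y).erase x) (n := s.card)
    (by rw [Finset.card_erase_of_mem hxD]; omega)
  let σ : Equiv.Perm K := (Finset.equivOfCardEq hs').extendSubtype
  have hσ : ∀ w, w ∈ s' ↔ σ w ∈ s := fun w => by
    refine ⟨fun hw => Equiv.extendSubtype_mem (Finset.equivOfCardEq hs') w hw, fun hw => ?_⟩
    by_contra hw'
    exact Equiv.extendSubtype_not_mem (Finset.equivOfCardEq hs') w hw' hw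
  refine ⟨(Y.erase y).map σ.toEmbedding, by rw [Finset.card_map, hcardD], fun w hw => ?_,
    fun p => (f p).map σ.toEmbedding, fun p q => ?_, fun p hp => ⟨?_, ?_, fun hps => ?_⟩⟩
  · refine Finset.mem_map.2 ⟨σ.symm w, ?_, by simp⟩
    exact Finset.mem_of_mem_erase (hs'D ((hσ _).2 (by simpa using hw)))
  · exact Finset.map_subset_map.trans (hf p q)
  · simpa [layers] using (hC p).1
  · exact Finset.map_subset_map.2 (hle p hp)
  · have h1 := hps (Finset.mem_map_of_mem σ.toEmbedding ((hf u p).2 (hu.2 p hp) hx))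
    exact (Finset.mem_erase.1 (hs'D ((hσ x).2 h1))).1 rfl

theorem card_le_of_mem_halfFamily {K R : Type*} {b j : ℕ} {F : Set (Finset R)}
    {S : Finset K × Finset R} (hS : S ∈ halfFamily K b j F) : S.1.card ≤ j := by
  rcases hS with h | h
  · exact h.2.1
  · exact h.1.le

theorem snd_of_mem_halfFamily {K R : Type*} {b j : ℕ} {F : Set (Finset R)}
    {S : Finset K × Finset R} (hS : S ∈ halfFamily K b j F) : S.2 = ∅ ∨ S.2 ∈ F := by
  rcases hS with h | h
  · exact .inl h.1
  · exact .inr h.2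

theorem not_hasCopy_halfFamily {P : Type*} [PartialOrder P] (hP : IsSpecial P) {K R : Type*}
    {b j : ℕ} {F : Set (Finset R)} (hF : ¬ HasCopy P F) {Y : Finset K} (hY : Y.card = j)
    (h : ¬ HasCopy P {c | c ∈ layers K b j ∧ c ⊆ Y}) :
    ¬ HasCopy P {S | S ∈ halfFamily K b j F ∧ S.1 ⊆ Y} := by
  rintro ⟨f, hf, hG⟩
  obtain ⟨z, hz, -⟩ := hP
  have key : ∀ p, (f p).2 = ∅ ∧ (f p).1 ∈ layers K b j ∨ (f p).1 = Y ∧ (f p).2 ∈ F := fun p =>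
    (hG p).1.imp_right fun hp => ⟨Finset.eq_of_subset_of_card_le (hG p).2 (hY.trans hp.1.symm).le,
      hp.2⟩
  have hle : ∀ p q, (f p).2 = ∅ → (f q).1 = Y → p ≤ q := fun p q hp hq =>
    (hf p q).1 ⟨hq ▸ (hG p).2, hp ▸ Finset.empty_subset _⟩
  rcases key z with hzs | hzl
  · have hall : ∀ p, (f p).2 = ∅ ∧ (f p).1 ∈ layers K b j := fun p => by
      by_cases hp : p = z
      · exact hp ▸ hzs
      · exact (key p).resolve_right fun hpl => (hz p hp).2 (hle z p hzs.1 hpl.1)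
    refine h ⟨fun p => (f p).1, fun p q => ?_, fun p => ⟨(hall p).2, (hG p).2⟩⟩
    rw [← hf, Prod.le_def, (hall p).1]
    simp
  · have hall : ∀ p, (f p).1 = Y ∧ (f p).2 ∈ F := fun p => by
      by_cases hp : p = z
      · exact hp ▸ hzl
      · exact (key p).resolve_left fun hps => (hz p hp).1 (hle p z hps.1 hzl.1)
    refine hF ⟨fun p => (f p).2, fun p q => ?_, fun p => (hall p).2⟩
    rw [← hf, Prod.le_def, (hall p).1, (hall q).1]
    simp

theorem hasCopy_halfFamily {P : Type*} [LE P] {K R : Type*} {b j : ℕ} (F : Set (Finset R))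
    {Y : Finset K} (h : HasCopy P {c | c ∈ layers K b j ∧ c ⊆ Y}) :
    HasCopy P {S | S ∈ halfFamily K b j F ∧ S ≤ (Y, ∅)} := by
  obtain ⟨f, hf, hC⟩ := h
  refine ⟨fun p => (f p, ∅), fun p q => by simp [← hf],
    fun p => ⟨.inl ⟨rfl, (hC p).1⟩, (hC p).2, le_rfl⟩⟩

theorem hasCopy_insert_halfFamily {P : Type*} [PartialOrder P] (hP : IsSpecial P)
    {K R : Type*} [Fintype K] [Fintype R] {b j : ℕ} {F : Set (Finset R)}
    (hF : SaturatedSet P F) (hbj : b ≤ j) (hK : j + 1 ≤ Fintype.card K)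
    (h : ∀ Y : Finset K, Y.card = j + 1 → HasCopy P {c | c ∈ layers K b j ∧ c ⊆ Y})
    {S : Finset K × Finset R} (hSj : S.1.card ≤ j) (hS2 : S.2 ≠ ∅)
    (hS : S ∉ halfFamily K b j F) :
    ∃ Y : Finset K, Y.card = j ∧
      HasCopy P {X | X ∈ insert S (halfFamily K b j F) ∧ X ≤ (Y, univ)} := by
  classical
  obtain ⟨s, r⟩ := S
  rcases hSj.eq_or_lt with hs | hs
  · obtain ⟨f, hf, hA⟩ := hF.2 r fun hr => hS (.inr ⟨hs, hr⟩)
    refine ⟨s, hs, fun p => (s, f p), fun p q => by simp [← hf], fun p => ⟨?_, ?_⟩⟩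
    · rcases hA p with hp | hp
      · exact .inl (congrArg (Prod.mk s) hp)
      · exact .inr (.inr ⟨hs, hp⟩)
    · exact ⟨le_rfl, Finset.subset_univ _⟩
  · obtain ⟨z, hz, ⟨t, ht⟩, u, hu⟩ := hP
    obtain ⟨T, hT, hsT, g, hg, hgC⟩ := exists_copy_not_subset ht hu (hz t ht.1).2 hbj hK h hs
    refine ⟨T, hT, fun p => if p = z then (s, r) else (g p, ∅), fun p q => ?_, fun p => ?_⟩
    · by_cases hp : p = z <;> by_cases hq : q = z
      · simp [hp, hq]
      · have := (hz q hq).2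
        simp_all
      · have := (hz p hp).1
        have := (hgC p hp).2.2
        simp_all
      · simp [hp, hq, hg]
    · by_cases hp : p = z
      · simpa [hp] using hsT
      · have h1 := hgC p hp
        simp only [hp, if_false]
        exact ⟨.inr (.inl ⟨rfl, h1.1⟩), h1.2.1, Finset.subset_univ _⟩

/-- For a suitable `b` and all large `j`, the layers contain a copy of `P` inside every
`j + 1`-set but inside no `j`-set. -/
theorem IsSpecial.exists_layers {P : Type*} [PartialOrder P] [Fintype P] (hP : IsSpecial P) :
    ∃ b j₀ : ℕ, ∀ j ≥ j₀, b ≤ j ∧ ∀ K : Type,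
      (∀ Y : Finset K, Y.card = j + 1 → HasCopy P {c | c ∈ layers K b j ∧ c ⊆ Y}) ∧
      ∀ Y : Finset K, Y.card = j → ¬ HasCopy P {c | c ∈ layers K b j ∧ c ⊆ Y} := by
  classical
  have hex := hP.exists_embedsInCodim
  obtain ⟨v, hv⟩ := Nat.find_spec hex
  refine ⟨Nat.find hex, max (Nat.find hex) v, fun j hj => ⟨le_of_max_le_left hj, fun K =>
    ⟨fun Y hY => hasCopy_layers_of_card hv ((le_of_max_le_right hj).trans j.le_succ) hY,
      fun Y hY => not_hasCopy_layers_of_card hP (fun _ => Nat.find_min hex) hY⟩⟩⟩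

theorem HasCopy.lex {P1 P2 L : Type*} [PartialOrder P1] [PartialOrder P2] [PartialOrder L]
    {A B G : Set L} (h1 : HasCopy P1 A) (h2 : HasCopy P2 B) (hA : A ⊆ G) (hB : B ⊆ G)
    (hAB : ∀ a ∈ A, ∀ b ∈ B, a < b) : HasCopy (P1 ⊕ₗ P2) G := by
  obtain ⟨f, hf, hfA⟩ := h1
  obtain ⟨g, hg, hgB⟩ := h2
  refine ⟨fun x => Sum.elim f g (ofLex x), ?_, ?_⟩
  · intro a b
    induction a using Lex.rec with | _ a => ?_
    induction b using Lex.rec with | _ b => ?_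
    rcases a with a | a <;> rcases b with b | b
    · simp [hf]
    · simpa using (hAB _ (hfA a) _ (hgB b)).le
    · simpa using (hAB _ (hfA b) _ (hgB a)).not_ge
    · simp [hg]
  · intro a
    induction a using Lex.rec with | _ a => ?_
    rcases a with a | a
    · exact hA (hfA a)
    · exact hB (hgB a)

/-- The family combining both halves has no copy of the linear sum, and every set outside it
whose part in `R` is neither empty nor everything completes such a copy. -/
theorem exists_glued_family (P1 P2 : Type*) [PartialOrder P1] [Fintype P1]
    [PartialOrder P2] [Fintype P2] (h1 : IsSpecial P1) (h2 : IsSpecial P2) :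
    ∃ j : ℕ, ∀ (R : Type) [Fintype R] [DecidableEq R] (F1 F2 : Set (Finset R)),
      SaturatedSet P1 F1 → SaturatedSet P2 F2 →
      ∃ G : Set (Finset (Fin (2 * j + 1)) × Finset R),
        (∀ S ∈ G, S.2 = ∅ ∨ S.2 = univ ∨ S.2 ∈ F1 ∨ S.2 ∈ F2) ∧
        ¬ HasCopy (P1 ⊕ₗ P2) G ∧
        ∀ S ∉ G, S.2 ≠ ∅ → S.2 ≠ univ → HasCopy (P1 ⊕ₗ P2) (insert S G) := by
  classical
  obtain ⟨b₁, j₁, hj₁⟩ := h1.exists_layers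
  obtain ⟨b₂, j₂, hj₂⟩ := h2.orderDual.exists_layers
  refine ⟨max j₁ j₂, fun R _ _ F1 F2 hF1 hF2 => ?_⟩
  set j := max j₁ j₂
  obtain ⟨hb₁, hl₁⟩ := hj₁ j (le_max_left _ _)
  obtain ⟨hb₂, hl₂⟩ := hj₂ j (le_max_right _ _)
  obtain ⟨hup₁, hno₁⟩ := hl₁ (Fin (2 * j + 1))
  obtain ⟨hup₂, hno₂⟩ := hl₂ (Fin (2 * j + 1))
  have hF2' := hF2.orderDual
  have hK : j + 1 ≤ Fintype.card (Fin (2 * j + 1)) := by simp; omega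
  let G1 := halfFamily (Fin (2 * j + 1)) b₁ j F1
  let H := halfFamily (Fin (2 * j + 1)) b₂ j (compl ⁻¹' F2)
  let G2 : Set (Finset (Fin (2 * j + 1)) × Finset R) := compl ⁻¹' H
  have hcc : ∀ s : Finset (Fin (2 * j + 1)), sᶜ.card + s.card = 2 * j + 1 := fun s => by
    simp
  have hG1 : ∀ S ∈ G1, S.1.card ≤ j := fun S hS => card_le_of_mem_halfFamily hS
  have hG2 : ∀ S ∈ G2, j < S.1.card := fun S hS => by
    have h3 : (S.1ᶜ).card ≤ j := card_le_of_mem_halfFamily hS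
    have h4 := hcc S.1
    omega
  have lt_of : ∀ X Z : Finset (Fin (2 * j + 1)) × Finset R, X.1.card ≤ j → j < Z.1.card →
      X ≤ Z → X < Z := fun X Z hX hZ h =>
    h.lt_of_ne fun he => by rw [he] at hX; omega
  refine ⟨G1 ∪ G2, ?_, ?_, ?_⟩
  · rintro S (hS | hS)
    · rcases snd_of_mem_halfFamily hS with h | h
      · exact .inl h
      · exact .inr (.inr (.inl h))
    · rcases snd_of_mem_halfFamily hS with h | h
      · exact .inr (.inl (by simpa using h))
      · exact .inr (.inr (.inr (by simpa using h)))
  · rintro ⟨f, hf, hG⟩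
    let f₁ : P1 → _ := fun p => f (Sum.inlₗ p)
    let f₂ : P2 → _ := fun p => f (Sum.inrₗ p)
    have hf₁ : ∀ p q, f₁ p ≤ f₁ q ↔ p ≤ q := fun p q => by simp [f₁, hf]
    have hf₂ : ∀ p q, f₂ p ≤ f₂ q ↔ p ≤ q := fun p q => by simp [f₂, hf]
    have hf₁₂ : ∀ p q, f₁ p ≤ f₂ q := fun p q => (hf _ _).2 (Sum.Lex.inl_le_inr _ _)
    let W : Finset (Fin (2 * j + 1)) := univ.biUnion fun p => (f₁ p).1
    have hW₁ : ∀ p, (f₁ p).1 ⊆ W := fun p =>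
      Finset.subset_biUnion_of_mem (fun p => (f₁ p).1) (Finset.mem_univ p)
    have hW₂ : ∀ q, W ⊆ (f₂ q).1 := fun q =>
      Finset.biUnion_subset.2 fun p _ => (hf₁₂ p q).1
    by_cases hWj : W.card ≤ j
    · obtain ⟨Y, hWY, -, hY⟩ := Finset.exists_subsuperset_card_eq (Finset.subset_univ W) hWj
        (by simp; omega)
      refine not_hasCopy_halfFamily h1 hF1.1 hY (hno₁ Y hY) ⟨f₁, hf₁, fun p => ⟨?_, ?_⟩⟩
      · refine (hG _).resolve_right fun hp => ?_
        have h3 := hG2 _ hp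
        have h4 := Finset.card_le_card (hW₁ p)
        exact absurd (h3.trans_le (h4.trans hWj)) (lt_irrefl _)
      · exact (hW₁ p).trans hWY
    · have hcW := hcc W
      obtain ⟨Y, hWY, -, hY⟩ := Finset.exists_subsuperset_card_eq (Finset.subset_univ Wᶜ)
        (n := j) (by omega) (by simp; omega)
      refine not_hasCopy_halfFamily h2.orderDual hF2'.1 hY (hno₂ Y hY)
        ⟨fun q => (f₂ (OrderDual.ofDual q))ᶜ, fun p q => ?_, fun q => ⟨?_, ?_⟩⟩
      · exact compl_le_compl_iff_le.trans (hf₂ _ _)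
      · refine (hG _).resolve_left fun hp => ?_
        have h3 : (f₂ (OrderDual.ofDual q)).1.card ≤ j := hG1 _ hp
        have h4 := Finset.card_le_card (hW₂ (OrderDual.ofDual q))
        omega
      · exact (compl_le_compl (hW₂ (OrderDual.ofDual q))).trans hWY
  · intro S hS hS0 hSu
    have hSG1 : S ∉ G1 := fun h => hS (.inl h)
    have hSG2 : Sᶜ ∉ H := fun h => hS (.inr h)
    by_cases hSj : S.1.card ≤ j
    · obtain ⟨Y, hY, hcopy⟩ := hasCopy_insert_halfFamily h1 hF1 hb₁ hK hup₁ hSj hS0 hSG1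
      have hYc : (Yᶜ).card = j + 1 := by have := hcc Y; omega
      have hcopy₂ : HasCopy P2 {X | X ∈ G2 ∧ (Y, univ) ≤ X} :=
        hasCopy_orderDual_compl.1 ((hasCopy_halfFamily (compl ⁻¹' F2) (hup₂ _ hYc)).mono fun X hX => ⟨by simpa [G2] using hX.1, by
            refine le_compl_comm.1 (hX.2.trans_eq ?_)
            ext <;> simp⟩)
      refine hcopy.lex hcopy₂ (fun X hX => ?_) (fun X hX => .inr (.inr hX.1)) ?_
      · exact hX.1.imp_right .inl
      · intro X hX Z hZ
        refine lt_of X Z ?_ (hG2 Z hZ.1) (hX.2.trans hZ.2)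
        rcases hX.1 with rfl | hX1
        · exact hSj
        · exact hG1 X hX1
    · have hSc : (Sᶜ).1.card ≤ j := by
        have := hcc S.1
        change (S.1ᶜ).card ≤ j
        omega
      obtain ⟨Y, hY, hcopy⟩ := hasCopy_insert_halfFamily h2.orderDual hF2' hb₂ hK hup₂ hSc
        (by simpa using hSu) hSG2
      have hYc : (Yᶜ).card = j + 1 := by have := hcc Y; omega
      have hcopy₂ : HasCopy P2 {X | X ∈ insert S G2 ∧ (Yᶜ, ∅) ≤ X} :=
        hasCopy_orderDual_compl.1 (hcopy.mono fun X hX => ⟨by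
            have h3 := hX.1
            rwa [← compl_compl X, ← Set.mem_preimage, compl_preimage_insert,
              compl_compl] at h3, by
            refine le_compl_comm.1 (hX.2.trans_eq ?_)
            ext <;> simp⟩)
      refine (hasCopy_halfFamily F1 (hup₁ _ hYc)).lex hcopy₂ (fun X hX => .inr (.inl hX.1))
        (fun X hX => hX.1.imp_right .inr) ?_
      intro X hX Z hZ
      refine lt_of X Z (hG1 X hX.1) ?_ (hX.2.trans hZ.2)
      rcases hZ.1 with rfl | hZ1
      · omega
      · exact hG2 Z hZ1

/-- Subsets of `[k + m]` correspond to pairs of a subset of `[k]` and a subset of `[m]`. -/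
def finsetFinAddEquiv (k m : ℕ) : Finset (Fin (k + m)) ≃o Finset (Fin k) × Finset (Fin m) :=
  OrderIso.trans
    { toEquiv := finSumFinEquiv.symm.finsetCongr
      map_rel_iff' := Finset.map_subset_map }
    Finset.sumEquiv

theorem hasCopy_preimage_orderIso {α L M : Type*} [LE α] [LE L] [LE M] (e : L ≃o M)
    (A : Set M) : HasCopy α (e ⁻¹' A) ↔ HasCopy α A := by
  constructor
  · rintro ⟨f, hf, hA⟩
    exact ⟨fun a => e (f a), fun a b => e.le_iff_le.trans (hf a b), hA⟩
  · rintro ⟨f, hf, hA⟩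
    exact ⟨fun a => e.symm (f a), fun a b => e.symm.le_iff_le.trans (hf a b),
      fun a => by simpa using hA a⟩

/-- If `P1`, `P2` are special posets whose saturation numbers are
bounded, then `sat*(n, P2 * P1)` is bounded. The linear sum `P2 * P1` (with `P1` at the
bottom) is encoded as `P1 ⊕ₗ P2`. -/
theorem statement11 (P1 P2 : Type*) [PartialOrder P1] [Fintype P1]
    [PartialOrder P2] [Fintype P2]
    (h1 : IsSpecial P1) (h2 : IsSpecial P2)
    (hb1 : ∃ C : ℕ, ∀ n : ℕ, satStar P1 n ≤ C)
    (hb2 : ∃ C : ℕ, ∀ n : ℕ, satStar P2 n ≤ C) :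
    ∃ C : ℕ, ∀ n : ℕ, satStar (P1 ⊕ₗ P2) n ≤ C := by
  classical
  have := h1.nonempty
  have := h2.nonempty
  have : Nonempty (P1 ⊕ₗ P2) := ⟨Sum.inlₗ (Classical.arbitrary P1)⟩
  obtain ⟨C1, hC1⟩ := hb1
  obtain ⟨C2, hC2⟩ := hb2
  obtain ⟨j, hj⟩ := exists_glued_family P1 P2 h1 h2
  refine ⟨2 ^ (2 * j + 1) * (2 + C1 + C2), fun n => ?_⟩
  rcases lt_or_ge n (2 * j + 1) with hn | hn
  · obtain ⟨𝒜, -, h𝒜⟩ := exists_isSaturatedFamily_card_eq_satStar (α := P1 ⊕ₗ P2) n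
    have h3 : 𝒜.card ≤ 2 ^ n := by simpa using Finset.card_le_univ 𝒜
    rw [← h𝒜]
    exact (h3.trans (Nat.pow_le_pow_right two_pos hn.le)).trans
      (Nat.le_mul_of_pos_right _ (by omega))
  · obtain ⟨m, rfl⟩ := Nat.exists_eq_add_of_le hn
    obtain ⟨F1, hF1, hF1c⟩ := exists_isSaturatedFamily_card_eq_satStar (α := P1) m
    obtain ⟨F2, hF2, hF2c⟩ := exists_isSaturatedFamily_card_eq_satStar (α := P2) m
    obtain ⟨G, hG, hfree, hsat⟩ := hj (Fin m) F1 F2 hF1.saturatedSet hF2.saturatedSet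
    let e := finsetFinAddEquiv (2 * j + 1) m
    let 𝒢 : Finset (Finset (Fin (2 * j + 1 + m))) := univ.filter fun S => e S ∈ G
    have h𝒢 : (𝒢 : Set (Finset (Fin (2 * j + 1 + m)))) = e ⁻¹' G := by ext; simp [𝒢]
    obtain ⟨𝒜, hsub, h𝒜⟩ := exists_isSaturatedFamily_superset (α := P1 ⊕ₗ P2) (𝒢 := 𝒢) (by
      rwa [containsCopy_iff_hasCopy, h𝒢, hasCopy_preimage_orderIso])
    let N : Finset (Finset (Fin m)) := {∅, univ} ∪ (F1 ∪ F2)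
    have hN : N.card ≤ 2 + C1 + C2 := by
      have h3 : N.card ≤ _ := Finset.card_union_le _ _
      have h4 := Finset.card_union_le F1 F2
      have h5 : ({∅, univ} : Finset (Finset (Fin m))).card ≤ 2 := Finset.card_le_two
      have h6 := hC1 m
      have h7 := hC2 m
      omega
    have hmem : ∀ S ∈ 𝒜, (e S).2 ∈ N := fun S hS => by
      by_contra hSN
      simp only [N, Finset.mem_union, Finset.mem_insert, Finset.mem_singleton, not_or] at hSN
      obtain ⟨⟨h3, h4⟩, h5, h6⟩ := hSN
      have hSG : e S ∉ G := fun h => by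
        rcases hG _ h with h | h | h | h
        · exact h3 h
        · exact h4 h
        · exact h5 (by simpa using h)
        · exact h6 (by simpa using h)
      refine h𝒜.1 ((containsCopy_iff_hasCopy 𝒜).2
        (((hasCopy_preimage_orderIso e _).2 (hsat _ hSG h3 h4)).mono fun X hX => ?_))
      rcases hX with hX | hX
      · rw [e.injective hX]
        exact hS
      · exact hsub (by simpa [𝒢] using hX)
    have h4 : satStar (P1 ⊕ₗ P2) (2 * j + 1 + m) ≤ 𝒜.card := Nat.sInf_le ⟨𝒜, h𝒜, rfl⟩
    refine h4.trans ?_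
    have h3 : 𝒜.card ≤ ((univ : Finset (Finset (Fin (2 * j + 1)))) ×ˢ N).card :=
      Finset.card_le_card_of_injOn e
        (fun S hS => Finset.mem_coe.2 (Finset.mem_product.2 ⟨Finset.mem_univ _, hmem S hS⟩))
        e.injective.injOn
    rw [Finset.card_product, Finset.card_univ, Fintype.card_finset, Fintype.card_fin] at h3
    exact h3.trans (Nat.mul_le_mul_left _ hN)
end
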